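/- arXiv:1612.07881 — 4 statements merged into one kernel-verified Lean document; each statement's English description precedes it below -/
import Mathlib

section
/- Let A and B be finite alphabets, let h : A* → B* be an injective monoid morphism, and let Y ⊆ A* be a complete set. Then h(Y) is synchronizing if and only if both Y and h(A) are synchronizing. -/
/-- The Kleene star of a set of words: the submonoid of the free monoid generated by `X`. -/
def Kstar {A : Type*} (X : Set (List A)) : Set (List A) :=
  {w | ∃ l : List (List A), (∀ x ∈ l, x ∈ X) ∧ l.flatten = w}

/-- `X` is complete: every word has an `X`-completion. -/
def IsCompleteSet {A : Type*} (X : Set (List A)) : Prop :=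
  ∀ w : List A, ∃ r s : List A, r ++ w ++ s ∈ Kstar X

/-- `(u, v)` is a synchronizing pair of `X`. -/
def IsSyncPair {A : Type*} (X : Set (List A)) (u v : List A) : Prop :=
  u ∈ Kstar X ∧ v ∈ Kstar X ∧
    ∀ r s : List A, r ++ (u ++ v) ++ s ∈ Kstar X →
      r ++ u ∈ Kstar X ∧ v ++ s ∈ Kstar X

/-- `X` is synchronizing: it has a synchronizing pair. -/
def IsSynchronizing {A : Type*} (X : Set (List A)) : Prop :=
  ∃ u v : List A, IsSyncPair X u v

/-- `c` is a constant of `X`. -/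
def IsConstant {A : Type*} (X : Set (List A)) (c : List A) : Prop :=
  c ∈ Kstar X ∧ ∀ u₁ u₂ u₃ u₄ : List A,
    u₁ ++ c ++ u₂ ∈ Kstar X → u₃ ++ c ++ u₄ ∈ Kstar X →
      u₁ ++ c ++ u₄ ∈ Kstar X ∧ u₃ ++ c ++ u₂ ∈ Kstar X

/-- `X` is a code: every word of `X*` has a unique factorization into words of `X`. -/
def IsCode {A : Type*} (X : Set (List A)) : Prop :=
  ∀ l₁ l₂ : List (List A), (∀ x ∈ l₁, x ∈ X) → (∀ x ∈ l₂, x ∈ X) →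
    l₁.flatten = l₂.flatten → l₁ = l₂

/-- `X` is a prefix code: no word of `X` is a proper prefix of another, and `X ≠ {ε}`. -/
def IsPrefixCode {A : Type*} (X : Set (List A)) : Prop :=
  (∀ x ∈ X, ∀ y ∈ X, x <+: y → x = y) ∧ X ≠ {([] : List A)}

/-- The monoid morphism `A* → B*` generated by the map `f` on letters. -/
def mlift {A B : Type*} (f : A → List B) : List A → List B :=
  fun w => (w.map f).flatten

theorem mlift_append {A B : Type*} (f : A → List B) (u v : List A) :
    mlift f (u ++ v) = mlift f u ++ mlift f v := by
  simp [mlift]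

theorem mlift_flatten {A B : Type*} (f : A → List B) (l : List (List A)) :
    mlift f l.flatten = (l.map (mlift f)).flatten := by
  induction l with
  | nil => rfl
  | cons x l ih => rw [List.flatten_cons, mlift_append, ih, List.map_cons, List.flatten_cons]

theorem append_mem_Kstar {A : Type*} {X : Set (List A)} {u v : List A}
    (hu : u ∈ Kstar X) (hv : v ∈ Kstar X) : u ++ v ∈ Kstar X := by
  obtain ⟨l, hl, rfl⟩ := hu
  obtain ⟨m, hm, rfl⟩ := hv
  refine ⟨l ++ m, fun x hx => ?_, List.flatten_append⟩
  exact (List.mem_append.1 hx).elim (hl x) (hm x)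

theorem Kstar_image_mlift {A B : Type*} (f : A → List B) (Y : Set (List A)) :
    Kstar (mlift f '' Y) = mlift f '' Kstar Y := by
  ext w
  constructor
  · rintro ⟨l, hl, rfl⟩
    obtain ⟨m, hm, rfl⟩ : ∃ m : List (List A), (∀ y ∈ m, y ∈ Y) ∧ m.map (mlift f) = l := by
      induction l with
      | nil => exact ⟨[], by simp, rfl⟩
      | cons x l ih =>
        obtain ⟨m, hm, rfl⟩ := ih fun y hy => hl y (List.mem_cons_of_mem x hy)
        obtain ⟨y, hy, rfl⟩ := hl x List.mem_cons_self
        exact ⟨y :: m, by simpa using ⟨hy, hm⟩, rfl⟩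
    exact ⟨m.flatten, ⟨m, hm, rfl⟩, mlift_flatten f m⟩
  · rintro ⟨_, ⟨l, hl, rfl⟩, rfl⟩
    refine ⟨l.map (mlift f), fun x hx => ?_, (mlift_flatten f l).symm⟩
    obtain ⟨y, hy, rfl⟩ := List.mem_map.1 hx
    exact ⟨y, hl y hy, rfl⟩

theorem Kstar_range {A B : Type*} (f : A → List B) :
    Kstar (Set.range f) = Set.range (mlift f) := by
  ext w
  constructor
  · rintro ⟨l, hl, rfl⟩
    obtain ⟨m, rfl⟩ : l ∈ Set.range (List.map f) := by
      rw [Set.range_list_map]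
      exact hl
    exact ⟨m, rfl⟩
  · rintro ⟨u, rfl⟩
    refine ⟨u.map f, fun x hx => ?_, rfl⟩
    obtain ⟨a, -, rfl⟩ := List.mem_map.1 hx
    exact ⟨a, rfl⟩

/-- The image of an injective morphism is a stable submonoid. -/
theorem mem_range_mlift_of_append {A B : Type*} {f : A → List B}
    (hinj : Function.Injective (mlift f)) {x y z : List B}
    (hx : x ∈ Set.range (mlift f)) (hz : z ∈ Set.range (mlift f))
    (hxy : x ++ y ∈ Set.range (mlift f)) (hyz : y ++ z ∈ Set.range (mlift f)) :
    y ∈ Set.range (mlift f) := by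
  obtain ⟨x, rfl⟩ := hx
  obtain ⟨z, rfl⟩ := hz
  obtain ⟨m, hm⟩ := hxy
  obtain ⟨n, hn⟩ := hyz
  have h : x ++ n = m ++ z := hinj (by simp [mlift_append, hm, hn])
  obtain ⟨t, rfl, -⟩ | ⟨t, rfl, -⟩ := List.append_eq_append_iff.1 h
  · exact ⟨t, List.append_cancel_left (by rw [← mlift_append, hm])⟩
  · rw [mlift_append, List.append_assoc, List.self_eq_append_right] at hm
    exact ⟨[], (List.append_eq_nil_iff.1 hm).2.symm⟩

theorem isSyncPair_of_image {A B : Type*} {f : A → List B}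
    (hinj : Function.Injective (mlift f)) {Y : Set (List A)} {u v : List A}
    (h : IsSyncPair (mlift f '' Y) (mlift f u) (mlift f v)) : IsSyncPair Y u v := by
  simpa only [IsSyncPair, Kstar_image_mlift, hinj.mem_set_image, ← mlift_append] using
    And.imp_right (And.imp_right fun H r s => H (mlift f r) (mlift f s)) h

theorem isSyncPair_range_of_image {A B : Type*} {f : A → List B}
    (hinj : Function.Injective (mlift f)) {Y : Set (List A)} (hcomp : IsCompleteSet Y)
    {u v : List B} (h : IsSyncPair (mlift f '' Y) u v) : IsSyncPair (Set.range f) u v := by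
  have hsub : Kstar (mlift f '' Y) ⊆ Set.range (mlift f) := by
    rw [Kstar_image_mlift]
    exact Set.image_subset_range _ _
  obtain ⟨hu, hv, H⟩ := h
  simp only [IsSyncPair, Kstar_range]
  refine ⟨hsub hu, hsub hv, ?_⟩
  rintro r s ⟨w, hw⟩
  obtain ⟨p, q, hpq⟩ := hcomp w
  obtain ⟨hl, hr⟩ := H (mlift f p ++ r) (s ++ mlift f q) (by
    rw [Kstar_image_mlift]
    exact ⟨_, hpq, by simp [mlift_append, hw]⟩)
  replace hl := hsub hl
  replace hr := hsub hr
  constructor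
  · refine mem_range_mlift_of_append hinj ⟨p, rfl⟩ hr (by simpa using hl) ⟨w ++ q, ?_⟩
    simp [mlift_append, hw]
  · refine mem_range_mlift_of_append hinj hl ⟨q, rfl⟩ ⟨p ++ w, ?_⟩ (by simpa using hr)
    simp [mlift_append, hw]

theorem isSynchronizing_image {A B : Type*} {f : A → List B}
    (hinj : Function.Injective (mlift f)) {Y : Set (List A)} (hcomp : IsCompleteSet Y)
    (hY : IsSynchronizing Y) (hf : IsSynchronizing (Set.range f)) :
    IsSynchronizing (mlift f '' Y) := by
  obtain ⟨u, v, hu, hv, hY⟩ := hY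
  obtain ⟨a, b, ha, hb, hX⟩ := hf
  rw [Kstar_range] at ha hb hX
  obtain ⟨a, rfl⟩ := ha
  obtain ⟨b, rfl⟩ := hb
  obtain ⟨p, q, hpq⟩ := hcomp (a ++ b)
  refine ⟨mlift f (p ++ (a ++ b) ++ q ++ u), mlift f (v ++ (p ++ (a ++ b) ++ q)), ?_⟩
  simp only [IsSyncPair, Kstar_image_mlift]
  refine ⟨⟨_, append_mem_Kstar hpq hu, rfl⟩, ⟨_, append_mem_Kstar hv hpq, rfl⟩, ?_⟩
  rintro r s ⟨w, hwY, hw⟩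
  simp only [mlift_append, List.append_assoc] at hw
  obtain ⟨⟨c, hc⟩, -⟩ := hX (r ++ mlift f p)
    (mlift f (q ++ u ++ v ++ p ++ a ++ b ++ q) ++ s) ⟨w, by simp [mlift_append, hw]⟩
  obtain ⟨-, ⟨d, hd⟩⟩ := hX (r ++ mlift f (p ++ a ++ b ++ q ++ u ++ v ++ p))
    (mlift f q ++ s) ⟨w, by simp [mlift_append, hw]⟩
  simp only [List.append_assoc] at hc
  obtain rfl : w = (c ++ b ++ q) ++ (u ++ v) ++ (p ++ a ++ d) :=
    hinj (by simp [mlift_append, hw, hc, hd])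
  obtain ⟨hl, hr⟩ := hY _ _ hwY
  exact ⟨⟨_, hl, by simp [mlift_append, hc]⟩, ⟨_, hr, by simp [mlift_append, hd]⟩⟩

/-- Let `h : A* → B*` be an injective morphism and `Y ⊆ A*` a complete set. Then `h(Y)` is
synchronizing iff `Y` and `h(A)` are synchronizing. -/
theorem image_synchronizing_iff {A B : Type*} [Fintype A] [Fintype B] (f : A → List B)
    (hinj : Function.Injective (mlift f)) (Y : Set (List A)) (hcomp : IsCompleteSet Y) :
    IsSynchronizing (mlift f '' Y) ↔ (IsSynchronizing Y ∧ IsSynchronizing (Set.range f)) := by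
  constructor
  · rintro ⟨u, v, h⟩
    refine ⟨?_, u, v, isSyncPair_range_of_image hinj hcomp h⟩
    obtain ⟨hu, hv, -⟩ := id h
    rw [Kstar_image_mlift] at hu hv
    obtain ⟨u, -, rfl⟩ := hu
    obtain ⟨v, -, rfl⟩ := hv
    exact ⟨u, v, isSyncPair_of_image hinj h⟩
  · rintro ⟨hY, hf⟩
    exact isSynchronizing_image hinj hcomp hY hf
end

section
/- Let A be a finite alphabet and let X ⊆ A* be a finite incomplete prefix code all of whose words have length at most n (n ≥ 1). Then X has an incompletable word of length at most 2n². -/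
/-- A state of the decoding automaton of `X`: a proper prefix of a word of `X`. -/
def IsDecodingState {A : Type*} (X : Set (List A)) (p : List A) : Prop :=
  ∃ x ∈ X, p <+: x ∧ p ≠ x

open Classical in
/-- The partial transition function of the decoding automaton of `X`; `none` is the sink. -/
noncomputable def decodeStep {A : Type*} (X : Set (List A)) :
    Option (List A) → A → Option (List A)
  | none, _ => none
  | some p, a =>
    if p ++ [a] ∈ X then some []
    else if ∃ x ∈ X, p ++ [a] <+: x then some (p ++ [a]) else none

/-- The state reached in the decoding automaton of `X` from `p` by reading a word. -/
noncomputable def decode {A : Type*} (X : Set (List A)) (p : Option (List A)) (w : List A) :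
    Option (List A) :=
  w.foldl (decodeStep X) p

section Decode

variable {A : Type*} {X : Set (List A)}

open Classical in
lemma decodeStep_some (p : List A) (a : A) : decodeStep X (some p) a =
    if p ++ [a] ∈ X then some []
    else if ∃ x ∈ X, p ++ [a] <+: x then some (p ++ [a]) else none := rfl

lemma decode_cons (p : Option (List A)) (a : A) (w : List A) :
    decode X p (a :: w) = decode X (decodeStep X p a) w := rfl

lemma decode_append (p : Option (List A)) (v w : List A) :
    decode X p (v ++ w) = decode X (decode X p v) w := List.foldl_append

lemma decode_none (w : List A) : decode X none w = none := by
  induction w with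
  | nil => rfl
  | cons a w ih => exact ih

lemma decodeStep_eq_some {p q : List A} {a : A} (h : decodeStep X (some p) a = some q) :
    (p ++ [a] ∈ X ∧ q = []) ∨
      (p ++ [a] ∉ X ∧ (∃ x ∈ X, p ++ [a] <+: x) ∧ q = p ++ [a]) := by
  rw [decodeStep_some] at h
  split_ifs at h with h1 h2
  · exact Or.inl ⟨h1, (Option.some.inj h).symm⟩
  · exact Or.inr ⟨h1, h2, (Option.some.inj h).symm⟩

lemma exists_of_decode_cons_eq_some {p q : List A} {a : A} {w : List A}
    (h : decode X (some p) (a :: w) = some q) :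
    ∃ m, decodeStep X (some p) a = some m ∧ decode X (some m) w = some q := by
  rw [decode_cons] at h
  cases hm : decodeStep X (some p) a with
  | none => simp [hm, decode_none] at h
  | some m => exact ⟨m, rfl, hm ▸ h⟩

lemma exists_of_decode_append_eq_some {p : Option (List A)} {q v w : List A}
    (h : decode X p (v ++ w) = some q) :
    ∃ m, decode X p v = some m ∧ decode X (some m) w = some q := by
  rw [decode_append] at h
  cases hm : decode X p v with
  | none => simp [hm, decode_none] at h
  | some m => exact ⟨m, rfl, hm ▸ h⟩

lemma IsDecodingState.decode {p q w : List A} (hp : IsDecodingState X p)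
    (h : decode X (some p) w = some q) : IsDecodingState X q := by
  induction w generalizing p with
  | nil => cases h; exact hp
  | cons a w ih =>
    obtain ⟨m, hm, hw⟩ := exists_of_decode_cons_eq_some h
    refine ih ?_ hw
    rcases decodeStep_eq_some hm with ⟨hx, rfl⟩ | ⟨hx, ⟨x, hxX, hpx⟩, rfl⟩
    · exact ⟨_, hx, List.nil_prefix, by simp⟩
    · exact ⟨x, hxX, hpx, fun e => hx (e ▸ hxX)⟩

lemma nil_mem_kstar : [] ∈ Kstar X := ⟨[], by simp, rfl⟩

lemma append_mem_kstar {x y : List A} (hx : x ∈ X) (hy : y ∈ Kstar X) : x ++ y ∈ Kstar X := by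
  obtain ⟨l, hl, rfl⟩ := hy
  exact ⟨x :: l, by simpa using ⟨hx, hl⟩, by simp⟩

lemma mem_kstar_append {x y : List A} (hy : y ∈ Kstar X) (hx : x ∈ X) : y ++ x ∈ Kstar X := by
  obtain ⟨l, hl, rfl⟩ := hy
  refine ⟨l ++ [x], ?_, by simp⟩
  intro z hz
  rcases List.mem_append.1 hz with hz | hz
  · exact hl z hz
  · rwa [List.mem_singleton.1 hz]

lemma exists_kstar_append_of_decode {p q w : List A} (h : decode X (some p) w = some q) :
    ∃ y ∈ Kstar X, p ++ w = y ++ q := by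
  induction w generalizing p with
  | nil => cases h; exact ⟨[], nil_mem_kstar, by simp⟩
  | cons a w ih =>
    obtain ⟨m, hm, hw⟩ := exists_of_decode_cons_eq_some h
    obtain ⟨y, hy, e⟩ := ih hw
    rcases decodeStep_eq_some hm with ⟨hx, rfl⟩ | ⟨-, -, rfl⟩
    · exact ⟨(p ++ [a]) ++ y, append_mem_kstar hx hy, by simp_all⟩
    · exact ⟨y, hy, by simpa using e⟩

lemma IsDecodingState.notMem (hX : IsPrefixCode X) {p : List A} (hp : IsDecodingState X p) :
    p ∉ X := by
  obtain ⟨x, hx, hpx, hne⟩ := hp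
  exact fun h => hne (hX.1 p h x hx hpx)

lemma IsPrefixCode.nil_notMem (hX : IsPrefixCode X) : [] ∉ X := by
  intro h
  exact hX.2 (Set.eq_singleton_iff_unique_mem.2
    ⟨h, fun x hx => (hX.1 [] h x hx List.nil_prefix).symm⟩)

lemma IsDecodingState.of_prefix {p q : List A} (hq : IsDecodingState X q) (h : p <+: q) :
    IsDecodingState X p := by
  obtain ⟨x, hx, hqx, hne⟩ := hq
  refine ⟨x, hx, h.trans hqx, ?_⟩
  rintro rfl
  exact hne (hqx.eq_of_length_le h.length_le)

lemma IsDecodingState.length_lt {n : ℕ} (hlen : ∀ w ∈ X, w.length ≤ n) {p : List A}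
    (hp : IsDecodingState X p) : p.length < n := by
  obtain ⟨x, hx, hpx, hne⟩ := hp
  refine lt_of_lt_of_le (lt_of_not_ge fun h => hne (hpx.eq_of_length_le h)) (hlen x hx)

lemma decode_eq_append (hX : IsPrefixCode X) {p v : List A} (h : IsDecodingState X (p ++ v)) :
    decode X (some p) v = some (p ++ v) := by
  induction v generalizing p with
  | nil => simp [decode]
  | cons a v ih =>
    have hstate : IsDecodingState X ((p ++ [a]) ++ v) := by simpa using h
    have hpa : IsDecodingState X (p ++ [a]) := hstate.of_prefix (List.prefix_append _ _)
    have hstep : decodeStep X (some p) a = some (p ++ [a]) := by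
      rw [decodeStep_some, if_neg (hpa.notMem hX)]
      obtain ⟨x, hx, hpx, -⟩ := hpa
      exact if_pos ⟨x, hx, hpx⟩
    rw [decode_cons, hstep, ih hstate]
    simp

lemma decode_eq_nil (hX : IsPrefixCode X) {p v : List A} (hv : v ≠ []) (h : p ++ v ∈ X) :
    decode X (some p) v = some [] := by
  obtain ⟨v, a, rfl⟩ := (List.eq_nil_or_concat' v).resolve_left hv
  have hstate : IsDecodingState X (p ++ v) := ⟨_, h, ⟨[a], by simp⟩, by simp⟩
  rw [decode_append, decode_eq_append hX hstate, decode_cons]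
  have h' : p ++ v ++ [a] ∈ X := by simpa using h
  rw [decodeStep_some, if_pos h']
  rfl

lemma decode_of_mem_kstar (hX : IsPrefixCode X) {w : List A} (hw : w ∈ Kstar X) :
    decode X (some []) w = some [] := by
  obtain ⟨l, hl, rfl⟩ := hw
  induction l with
  | nil => rfl
  | cons x l ih =>
    have hx : x ∈ X := hl x (by simp)
    rw [List.flatten_cons, decode_append,
      decode_eq_nil hX (fun e => hX.nil_notMem (e ▸ hx)) (by simpa using hx)]
    exact ih fun y hy => hl y (by simp [hy])

lemma IsDecodingState.nil (hX : IsPrefixCode X) (hne : X.Nonempty) : IsDecodingState X [] := by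
  obtain ⟨x, hx⟩ := hne
  exact ⟨x, hx, List.nil_prefix, fun e => hX.nil_notMem (e ▸ hx)⟩

/-- If every word of length `n` can be read from the initial state, then `X` is complete. -/
lemma isCompleteSet_of_decode_ne_none (hX : IsPrefixCode X) (hne : X.Nonempty) {n : ℕ}
    (hlen : ∀ w ∈ X, w.length ≤ n)
    (h : ∀ u : List A, u.length = n → decode X (some []) u ≠ none) : IsCompleteSet X := by
  have hstep (p : List A) (a : A) (hp : IsDecodingState X p) :
      decodeStep X (some p) a ≠ none := by
    intro hnone
    have hpn := hp.length_lt hlen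
    refine h (p ++ a :: List.replicate (n - (p.length + 1)) a) (by simp; omega) ?_
    rw [decode_append, decode_eq_append hX (p := []) hp, List.nil_append, decode_cons, hnone,
      decode_none]
  have hread (w : List A) : ∀ p, IsDecodingState X p → decode X (some p) w ≠ none := by
    induction w with
    | nil => intro p _ e; cases e
    | cons a w ih =>
      intro p hp
      obtain ⟨q, hq⟩ := Option.ne_none_iff_exists'.1 (hstep p a hp)
      rw [decode_cons, hq]
      exact ih q (hp.decode (w := [a]) hq)
  intro w
  have h0 := IsDecodingState.nil hX hne
  obtain ⟨q, hq⟩ := Option.ne_none_iff_exists'.1 (hread w [] h0)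
  obtain ⟨y, hy, e⟩ := exists_kstar_append_of_decode hq
  obtain ⟨x, hx, ⟨s, rfl⟩, -⟩ := h0.decode hq
  refine ⟨[], s, ?_⟩
  rw [e, List.append_assoc]
  exact mem_kstar_append hy hx

/-- A finite set of states is sent to the sink by a word of length linear in its cardinality. -/
lemma exists_decode_eq_none (hX : IsPrefixCode X) (hne : X.Nonempty) {n : ℕ}
    (hlen : ∀ w ∈ X, w.length ≤ n) {u : List A} (hu : u.length = n)
    (hroot : decode X (some []) u = none) (m : ℕ) (S : Finset (List A)) (hcard : S.card ≤ m)
    (hS : ∀ q ∈ S, IsDecodingState X q) :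
    ∃ v : List A, v.length ≤ 2 * n * m ∧ ∀ q ∈ S, decode X (some q) v = none := by
  classical
  induction m generalizing S with
  | zero =>
    obtain rfl := Finset.card_eq_zero.1 (Nat.le_zero.1 hcard)
    exact ⟨[], by simp, by simp⟩
  | succ m ih =>
    rcases S.eq_empty_or_nonempty with rfl | ⟨q, hq⟩
    · exact ⟨[], by simp, by simp⟩
    obtain ⟨x, hx, ⟨s, rfl⟩, hqx⟩ := hS q hq
    have hs : s ≠ [] := by rintro rfl; simp at hqx
    have hsn : s.length ≤ n := by
      have := hlen _ hx
      rw [List.length_append] at this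
      omega
    have hkill : decode X (some q) (s ++ u) = none := by
      rw [decode_append, decode_eq_nil hX hs hx, hroot]
    obtain ⟨v, hv, hvS⟩ := ih
      ((S.erase q).image fun p => (decode X (some p) (s ++ u)).getD [])
      (Finset.card_image_le.trans (by rw [Finset.card_erase_of_mem hq]; omega))
      (by
        intro r hr
        obtain ⟨p, hp, rfl⟩ := Finset.mem_image.1 hr
        cases hd : decode X (some p) (s ++ u) with
        | none => exact IsDecodingState.nil hX hne
        | some p' => exact (hS p (Finset.mem_of_mem_erase hp)).decode hd)
    refine ⟨s ++ u ++ v, ?_, fun p hp => ?_⟩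
    · simp only [List.length_append, hu]
      rw [Nat.mul_succ]
      omega
    · rw [decode_append]
      by_cases hpq : p = q
      · rw [hpq, hkill, decode_none]
      cases hd : decode X (some p) (s ++ u) with
      | none => exact decode_none v
      | some p' =>
        exact hvS p' (Finset.mem_image.2 ⟨p, Finset.mem_erase.2 ⟨hpq, hp⟩, by simp [hd]⟩)

/-- A state reached by reading a word of length `n` is a suffix of that word. -/
lemma eq_drop_of_decode {n : ℕ} (hlen : ∀ w ∈ X, w.length ≤ n) {p q u : List A}
    (hu : u.length = n) (hp : IsDecodingState X p) (h : decode X (some p) u = some q) :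
    q = u.drop (n - q.length) := by
  obtain ⟨y, -, e⟩ := exists_kstar_append_of_decode h
  have hq := (hp.decode h).length_lt hlen
  have hsuff : q <:+ u :=
    List.suffix_of_suffix_length_le ⟨y, e.symm⟩ (List.suffix_append p u) (by omega)
  rw [← hu]
  exact List.suffix_iff_eq_drop.1 hsuff

end Decode

/-- A finite incomplete prefix code with words of length at most `n` has an incompletable
word of length at most `2n²`. -/
theorem incompletable_prefix_code_quadratic {A : Type*} [Fintype A] (n : ℕ) (hn : 1 ≤ n)
    (X : Set (List A)) (hfin : X.Finite) (hpref : IsPrefixCode X)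
    (hlen : ∀ w ∈ X, w.length ≤ n) (hinc : ¬ IsCompleteSet X) :
    ∃ w : List A, (∀ p s : List A, p ++ w ++ s ∉ Kstar X) ∧ w.length ≤ 2 * n ^ 2 := by
  classical
  rcases X.eq_empty_or_nonempty with rfl | hne
  · cases isEmpty_or_nonempty A with
    | inl hA =>
      refine absurd (fun w => ⟨[], [], ?_⟩) hinc
      rw [Subsingleton.elim w []]
      exact nil_mem_kstar
    | inr hA =>
      obtain ⟨a⟩ := hA
      refine ⟨[a], fun p s h => ?_, by simp; nlinarith⟩
      obtain ⟨_, h1, -⟩ := exists_of_decode_append_eq_some (decode_of_mem_kstar hpref h)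
      obtain ⟨q, -, h2⟩ := exists_of_decode_append_eq_some h1
      simp [decode, decodeStep_some] at h2
  obtain ⟨u, hu, hroot⟩ : ∃ u : List A, u.length = n ∧ decode X (some []) u = none := by
    by_contra! h
    exact hinc (isCompleteSet_of_decode_ne_none hpref hne hlen h)
  have h0 := IsDecodingState.nil hpref hne
  let S := ((Finset.Ico 1 n).image u.drop).filter (IsDecodingState X)
  have hcard : (S.image fun p => (decode X (some p) u).getD []).card ≤ n - 1 :=
    Finset.card_image_le.trans <| (Finset.card_filter_le _ _).trans <|
      Finset.card_image_le.trans (by simp)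
  obtain ⟨v, hv, hvS⟩ := exists_decode_eq_none hpref hne hlen hu hroot (n - 1) _ hcard (by
    intro r hr
    obtain ⟨p, hp, rfl⟩ := Finset.mem_image.1 hr
    cases hd : decode X (some p) u with
    | none => exact h0
    | some p' => exact (Finset.mem_filter.1 hp).2.decode hd)
  refine ⟨u ++ (u ++ v), fun p s h => ?_, ?_⟩
  · obtain ⟨_, h1, -⟩ := exists_of_decode_append_eq_some (decode_of_mem_kstar hpref h)
    obtain ⟨p', hp', h2⟩ := exists_of_decode_append_eq_some h1
    obtain ⟨q, hq, h3⟩ := exists_of_decode_append_eq_some h2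
    obtain ⟨r, hr, h4⟩ := exists_of_decode_append_eq_some h3
    have hps := h0.decode hp'
    have hqs := hps.decode hq
    have hqn := hqs.length_lt hlen
    have hq0 : q ≠ [] := by rintro rfl; simp [hroot] at hr
    have hqpos := List.length_pos_iff.2 hq0
    have hqS : q ∈ S := Finset.mem_filter.2 ⟨Finset.mem_image.2 ⟨n - q.length,
      Finset.mem_Ico.2 (by omega), (eq_drop_of_decode hlen hu hps hq).symm⟩, hqs⟩
    have hdead := hvS r (Finset.mem_image.2 ⟨q, hqS, by simp [hr]⟩)
    simp [hdead] at h4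
  · obtain ⟨k, rfl⟩ := Nat.exists_eq_add_of_le' hn
    simp only [List.length_append, hu]
    simp only [Nat.add_sub_cancel] at hv
    nlinarith
end

section
/- Let B = {a, b} be a binary alphabet, let m ≥ 1, and let X be a set of words over B all of length exactly m such that aᵐ ∉ X, aᵐ⁻¹b ∈ X, and baᵐ⁻¹ ∈ X. Then X is a prefix code and (baᵐ⁻¹, aᵐ⁻¹b) is a synchronizing pair of X. -/
/-- If all words of `X` have length `m`, a word of `X*` splits inside `X*` at every multiple
of `m`. -/
theorem Kstar.of_append {A : Type*} {X : Set (List A)} {m : ℕ} (hlen : ∀ w ∈ X, w.length = m)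
    {x y : List A} (h : x ++ y ∈ Kstar X) (hx : m ∣ x.length) : x ∈ Kstar X ∧ y ∈ Kstar X := by
  obtain ⟨k, hk⟩ := hx
  induction k generalizing x with
  | zero =>
    obtain rfl : x = [] := List.length_eq_zero_iff.mp (by simpa using hk)
    exact ⟨⟨[], by simp, rfl⟩, h⟩
  | succ k ih =>
    obtain ⟨l, hl, hf⟩ := h
    cases l with
    | nil =>
      obtain ⟨rfl, rfl⟩ := List.append_eq_nil_iff.mp hf.symm
      exact ⟨⟨[], by simp, rfl⟩, ⟨[], by simp, rfl⟩⟩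
    | cons w l =>
      have hw := hlen w (hl w (by simp))
      have hle : w.length ≤ x.length := by rw [hk, hw]; exact Nat.le_mul_of_pos_right _ (by simp)
      rw [List.flatten_cons] at hf
      obtain ⟨z, rfl⟩ : w <+: x :=
        List.prefix_of_prefix_length_le ⟨_, hf⟩ (List.prefix_append x y) hle
      rw [List.append_assoc, List.append_cancel_left_eq] at hf
      have hz : z.length = m * k := by
        rw [List.length_append, hw, Nat.mul_succ] at hk
        omega
      obtain ⟨⟨l', hl', hf'⟩, hy⟩ :=
        ih ⟨l, fun v hv => hl v (List.mem_cons_of_mem _ hv), hf⟩ hz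
      refine ⟨⟨w :: l', ?_, by rw [List.flatten_cons, hf']⟩, hy⟩
      intro v hv
      rcases List.mem_cons.mp hv with rfl | hv
      · exact hl _ (by simp)
      · exact hl' v hv

theorem Kstar.subset {A : Type*} {X : Set (List A)} : X ⊆ Kstar X :=
  fun w hw => ⟨[w], by simpa using hw, by simp⟩

/-- If all words of `X` have length `m ≥ 1`, a word of `X*` of length `m` lies in `X`. -/
theorem Kstar.mem_of_length_eq {A : Type*} {X : Set (List A)} {m : ℕ} (hm : 1 ≤ m)
    (hlen : ∀ w ∈ X, w.length = m) {x : List A} (h : x ∈ Kstar X) (hx : x.length = m) :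
    x ∈ X := by
  obtain ⟨l, hl, rfl⟩ := h
  match l with
  | [] => simp at hx; omega
  | [w] => simpa using hl
  | w :: v :: l =>
    have hw := hlen w (hl w (by simp))
    have hv := hlen v (hl v (by simp))
    simp only [List.flatten_cons, List.length_append] at hx
    omega

/-- Let `X` be a set of binary words, all of length exactly `m`, with `aᵐ ∉ X`,
`aᵐ⁻¹b ∈ X` and `baᵐ⁻¹ ∈ X` (where `a = 0`, `b = 1`). Then `X` is a prefix code and
`(baᵐ⁻¹, aᵐ⁻¹b)` is a synchronizing pair of `X`. -/
theorem uniform_code_syncPair (m : ℕ) (hm : 1 ≤ m) (X : Set (List (Fin 2)))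
    (hlen : ∀ w ∈ X, w.length = m)
    (h1 : List.replicate m (0 : Fin 2) ∉ X)
    (h2 : List.replicate (m - 1) (0 : Fin 2) ++ [(1 : Fin 2)] ∈ X)
    (h3 : (1 : Fin 2) :: List.replicate (m - 1) (0 : Fin 2) ∈ X) :
    IsPrefixCode X ∧
      IsSyncPair X ((1 : Fin 2) :: List.replicate (m - 1) (0 : Fin 2))
        (List.replicate (m - 1) (0 : Fin 2) ++ [(1 : Fin 2)]) := by
  refine ⟨⟨fun x hx y hy h => h.eq_of_length ((hlen x hx).trans (hlen y hy).symm), ?_⟩,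
    Kstar.subset h3, Kstar.subset h2, fun r s h => ?_⟩
  · rintro rfl
    simp at h2
  suffices hr : m ∣ r.length by
    rw [← List.append_assoc, List.append_assoc _ _ s] at h
    refine Kstar.of_append hlen h ?_
    rw [List.length_append, hlen _ h3]
    exact dvd_add hr dvd_rfl
  by_contra hr
  have ht : 0 < r.length % m := Nat.pos_of_ne_zero fun h0 => hr (Nat.dvd_of_mod_eq_zero h0)
  have ht' : r.length % m < m := Nat.mod_lt _ hm
  have hq := Nat.mod_add_div r.length m
  generalize r.length % m = t at ht ht' hq
  have hsplit : (List.replicate (m - 1) (0 : Fin 2)) ++ List.replicate (m - 1) 0 =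
      List.replicate (m - t - 1) 0 ++ (List.replicate m 0 ++ List.replicate (t - 1) 0) := by
    simp only [List.replicate_append_replicate]
    congr 1
    omega
  have heq : r ++ (((1 : Fin 2) :: List.replicate (m - 1) 0) ++
      (List.replicate (m - 1) 0 ++ [1])) ++ s =
      (r ++ 1 :: List.replicate (m - t - 1) 0) ++
        (List.replicate m 0 ++ (List.replicate (t - 1) 0 ++ 1 :: s)) := by
    have := congrArg (fun z => r ++ 1 :: (z ++ 1 :: s)) hsplit
    simpa only [List.append_assoc, List.cons_append, List.nil_append] using this
  rw [heq] at h
  have hdvd : m ∣ (r ++ (1 : Fin 2) :: List.replicate (m - t - 1) 0).length := by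
    refine ⟨r.length / m + 1, ?_⟩
    rw [List.length_append, List.length_cons, List.length_replicate, Nat.mul_succ]
    omega
  have ha := (Kstar.of_append hlen (Kstar.of_append hlen h hdvd).2 (by simp)).1
  exact h1 (Kstar.mem_of_length_eq hm hlen ha (by simp))
end

section
/- Let A = {a, b} be a binary alphabet, let n ≥ 3, and let Xₙ = aA^{n−1} ∪ bA^{n−2} (the set of all words of length n beginning with a together with all words of length n−1 beginning with b). Then every synchronizing pair (w₁, w₂) of Xₙ satisfies |w₁·w₂| ≥ (n−1)². -/
/-- The set `Xₙ = aA^{n-1} ∪ bA^{n-2}` over `A = {a, b}`, with `a = 0` and `b = 1`. -/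
def wielandtSet (n : ℕ) : Set (List (Fin 2)) :=
  {w : List (Fin 2) |
    (∃ t : List (Fin 2), w = (0 : Fin 2) :: t ∧ t.length = n - 1) ∨
    (∃ t : List (Fin 2), w = (1 : Fin 2) :: t ∧ t.length = n - 2)}

lemma Kstar.nil_mem {A : Type*} (X : Set (List A)) : [] ∈ Kstar X :=
  ⟨[], by simp, rfl⟩

lemma Kstar.append_mem {A : Type*} {X : Set (List A)} {x w : List A}
    (hx : x ∈ X) (hw : w ∈ Kstar X) : x ++ w ∈ Kstar X := by
  obtain ⟨l, hl, rfl⟩ := hw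
  exact ⟨x :: l, by simpa using ⟨hx, hl⟩, by simp⟩

lemma exists_length_mem_wielandtSet (n : ℕ) (c : Fin 2) :
    ∃ k, ∀ t : List (Fin 2), t.length = k → c :: t ∈ wielandtSet n := by
  fin_cases c
  · exact ⟨n - 1, fun t ht => Or.inl ⟨t, rfl, ht⟩⟩
  · exact ⟨n - 2, fun t ht => Or.inr ⟨t, rfl, ht⟩⟩

/-- Every word is a prefix of a word of `Xₙ*`. -/
lemma exists_append_mem_kstar_wielandtSet (n : ℕ) (w : List (Fin 2)) :
    ∃ s, w ++ s ∈ Kstar (wielandtSet n) := by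
  match w with
  | [] => exact ⟨[], Kstar.nil_mem _⟩
  | c :: t =>
    obtain ⟨k, hk⟩ := exists_length_mem_wielandtSet n c
    rcases le_total t.length k with h | h
    · refine ⟨List.replicate (k - t.length) 0, ?_⟩
      have := Kstar.append_mem (hk (t ++ List.replicate (k - t.length) 0)
        (by simp; omega)) (Kstar.nil_mem _)
      simpa using this
    · obtain ⟨s, hs⟩ := exists_append_mem_kstar_wielandtSet n (t.drop k)
      refine ⟨s, ?_⟩
      have := Kstar.append_mem (hk (t.take k) (by simpa using h)) hs
      simpa [← List.append_assoc] using this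
termination_by w.length
decreasing_by simp

lemma length_flatten_of_mem_wielandtSet {n : ℕ} (hn : 2 ≤ n) (l : List (List (Fin 2)))
    (hl : ∀ x ∈ l, x ∈ wielandtSet n) :
    ∃ i j, l.flatten.length = i * n + j * (n - 1) := by
  induction l with
  | nil => exact ⟨0, 0, by simp⟩
  | cons x l ih =>
    obtain ⟨i, j, hij⟩ := ih fun y hy => hl y (by simp [hy])
    rcases hl x (by simp) with ⟨t, rfl, ht⟩ | ⟨t, rfl, ht⟩
    · refine ⟨i + 1, j, ?_⟩
      rw [List.flatten_cons, List.length_append, hij, List.length_cons, add_mul]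
      omega
    · refine ⟨i, j + 1, ?_⟩
      rw [List.flatten_cons, List.length_append, hij, List.length_cons, add_mul]
      omega

/-- A word of `Xₙ*` beginning with `a` has at least one factor of length `n`. -/
lemma length_of_cons_zero_mem_kstar_wielandtSet {n : ℕ} (hn : 2 ≤ n) {w : List (Fin 2)}
    (hw : 0 :: w ∈ Kstar (wielandtSet n)) :
    ∃ i j, w.length + 1 = n + i * n + j * (n - 1) := by
  obtain ⟨l, hl, h⟩ := hw
  induction l with
  | nil => simp at h
  | cons x l =>
    obtain ⟨i, j, hij⟩ :=
      length_flatten_of_mem_wielandtSet hn l fun y hy => hl y (by simp [hy])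
    rcases hl x (by simp) with ⟨t, rfl, ht⟩ | ⟨t, rfl, ht⟩
    · refine ⟨i, j, ?_⟩
      have := congrArg List.length h
      rw [List.flatten_cons, List.length_append, hij, List.length_cons, List.length_cons] at this
      omega
    · simp at h

/-- For `Xₙ = aA^{n-1} ∪ bA^{n-2}` over `A = {a, b}` (with `a = 0`, `b = 1`), every
synchronizing pair `(w₁, w₂)` of `Xₙ` satisfies `|w₁w₂| ≥ (n-1)²`. -/
theorem syncPair_of_Xn_lower_bound (n : ℕ) (hn : 3 ≤ n) (w₁ w₂ : List (Fin 2))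
    (h : IsSyncPair
      {w : List (Fin 2) |
        (∃ t : List (Fin 2), w = (0 : Fin 2) :: t ∧ t.length = n - 1) ∨
        (∃ t : List (Fin 2), w = (1 : Fin 2) :: t ∧ t.length = n - 2)}
      w₁ w₂) :
    (n - 1) ^ 2 ≤ (w₁ ++ w₂).length := by
  obtain ⟨m, rfl⟩ : ∃ m, n = m + 1 := ⟨n - 1, by omega⟩
  set L := w₁.length with hL
  have hmod := Nat.mod_lt (L + m) (show 0 < m + 1 by omega)
  have hdiv := Nat.div_add_mod (L + m) (m + 1)
  set q := m - (L + m) % (m + 1) with hq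
  set k := (L + m) / (m + 1)
  obtain ⟨s, hs⟩ := exists_append_mem_kstar_wielandtSet (m + 1)
    ((0 :: List.replicate q 0) ++ (w₁ ++ w₂))
  obtain ⟨i, j, hij⟩ :=
    length_of_cons_zero_mem_kstar_wielandtSet (by omega) (h.2.2 _ _ hs).1
  simp only [List.append_eq, List.length_append, List.length_replicate, ← hL, Nat.add_sub_cancel] at hij ⊢
  have hkey : q + L = (m + 1) * k := by omega
  have hdvd : m + 1 ∣ j + 1 := by
    have hsum : (m + 1) * k + (j + 1) = (m + 1) * (i + j + 1) := by
      linarith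
    exact (Nat.dvd_add_right (dvd_mul_right _ k)).mp ⟨_, hsum⟩
  have hj : m ≤ j := by
    have := Nat.le_of_dvd (Nat.succ_pos j) hdvd
    omega
  have hmul : m * m ≤ j * m := Nat.mul_le_mul_right m hj
  rw [pow_two]
  omega
end
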